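/- arXiv:1001.2759 — 3 statements merged into one kernel-verified Lean document; each statement's English description precedes it below -/
import Mathlib

section
/- Let E be a 4×4 real symmetric matrix with trace zero. Then the trace of E³ is at most (1/√3)·(trace E²)^{3/2}; equivalently, tr(E³) ≤ (1/√3)|E|³ where |E| denotes the Frobenius norm of E. -/
lemma aux_trace_pow (E : Matrix (Fin 4) (Fin 4) ℝ) (hE : E.IsHermitian) (k : ℕ) :
    (E ^ k).trace = ∑ i, (hE.eigenvalues i) ^ k := by
  have h := hE.spectral_theorem
  have h2 : E ^ k = Unitary.conjStarAlgAut ℝ _ hE.eigenvectorUnitary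
      ((Matrix.diagonal (RCLike.ofReal ∘ hE.eigenvalues)) ^ k) := by
    rw [map_pow, ← h]
  rw [h2, Unitary.conjStarAlgAut_apply, Matrix.trace_mul_cycle, Unitary.coe_star_mul_self,
    one_mul, Matrix.diagonal_pow, Matrix.trace_diagonal]
  simp

lemma aux_bound (x y z w t : ℝ) (ht : 0 ≤ t) (h : x + y + z + w = 0)
    (h2 : x ^ 2 + y ^ 2 + z ^ 2 + w ^ 2 = 12 * t ^ 2) : x ≤ 3 * t := by
  have hx : w = -x - y - z := by linarith
  subst hx
  refine (abs_le_of_sq_le_sq' ?_ (by positivity)).2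
  nlinarith [sq_nonneg (y - z), sq_nonneg (x + 3 * y), sq_nonneg (x + 3 * z)]

lemma aux_scalar (x y z w t : ℝ) (ht : 0 ≤ t) (h : x + y + z + w = 0)
    (h2 : x ^ 2 + y ^ 2 + z ^ 2 + w ^ 2 = 12 * t ^ 2) :
    x ^ 3 + y ^ 3 + z ^ 3 + w ^ 3 ≤ 24 * t ^ 3 := by
  have a := mul_nonneg (sub_nonneg.2 (aux_bound x y z w t ht h h2)) (sq_nonneg (x + t))
  have b := mul_nonneg (sub_nonneg.2 (aux_bound y x z w t ht (by linarith) (by linarith)))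
    (sq_nonneg (y + t))
  have c := mul_nonneg (sub_nonneg.2 (aux_bound z x y w t ht (by linarith) (by linarith)))
    (sq_nonneg (z + t))
  have d := mul_nonneg (sub_nonneg.2 (aux_bound w x y z t ht (by linarith) (by linarith)))
    (sq_nonneg (w + t))
  linear_combination a + b + c + d + t * h2 + 5 * t ^ 2 * h

/-- For a 4×4 real symmetric matrix `E` with trace zero, the trace of `E ^ 3` is at most
`(1 / √3) * (trace (E ^ 2)) ^ (3/2)`; note `trace (E ^ 2)` is the square of the
Frobenius norm of `E`. -/
theorem traceless_symm_cubic_trace_bound (E : Matrix (Fin 4) (Fin 4) ℝ)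
    (hE : E.IsSymm) (htr : E.trace = 0) :
    (E ^ 3).trace ≤ (1 / Real.sqrt 3) * ((E ^ 2).trace) ^ ((3 : ℝ) / 2) := by
  have hH : E.IsHermitian := by
    rw [Matrix.IsHermitian, Matrix.conjTranspose_eq_transpose_of_trivial]; exact hE
  have h1 := aux_trace_pow E hH 1
  have h2 := aux_trace_pow E hH 2
  have h3 := aux_trace_pow E hH 3
  rw [pow_one, htr] at h1
  simp only [Fin.sum_univ_four, pow_one] at h1 h2 h3
  have hS : 0 ≤ (E ^ 2).trace := by rw [h2]; positivity
  have hr : ((E ^ 2).trace) ^ ((3 : ℝ) / 2) = (Real.sqrt (E ^ 2).trace) ^ 3 := by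
    rw [Real.sqrt_eq_rpow, ← Real.rpow_natCast, ← Real.rpow_mul hS]; norm_num
  have hq := Real.sq_sqrt hS
  have h0 := Real.sqrt_nonneg (E ^ 2).trace
  rw [hr, h3]
  set r := Real.sqrt (E ^ 2).trace
  have hs : Real.sqrt 3 ^ 2 = 3 := Real.sq_sqrt (by norm_num)
  have hsp : 0 < Real.sqrt 3 := by positivity
  have key := aux_scalar _ _ _ _ (r / (2 * Real.sqrt 3)) (by positivity) h1.symm (by
    rw [← h2, ← hq, div_pow, mul_pow, hs]; ring)
  refine key.trans (le_of_eq ?_)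
  have h4 : Real.sqrt 3 ^ 3 = 3 * Real.sqrt 3 := by rw [pow_succ, hs]
  rw [div_pow, mul_pow, h4]
  field_simp
  norm_num
  ring
end

section
/- Let n ≥ 1, let μ be a measure on Euclidean space ℝⁿ, let u : ℝⁿ → ℝ be a nonnegative measurable function with ∫ u² dμ < ∞, and let c' > 0. Suppose that for every smooth compactly supported function φ : ℝⁿ → ℝ with 0 ≤ φ ≤ 1 one has c'·(∫ φ⁴ u⁴ dμ)^{1/2} ≤ ∫ ‖Dφ‖² u² dμ. Then u = 0 μ-almost everywhere. -/
open MeasureTheory in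
/-- Analytic vanishing lemma: if a nonnegative measurable `u` with `∫ u² dμ < ∞` satisfies
`c' * (∫ φ⁴ u⁴ dμ)^{1/2} ≤ ∫ ‖Dφ‖² u² dμ` for every smooth compactly supported cutoff
`0 ≤ φ ≤ 1`, then `u = 0` μ-a.e. -/
theorem vanishing_from_cutoff_estimate (n : ℕ) (hn : 1 ≤ n)
    (μ : Measure (EuclideanSpace ℝ (Fin n)))
    (u : EuclideanSpace ℝ (Fin n) → ℝ) (hu_meas : Measurable u) (hu_nonneg : ∀ x, 0 ≤ u x)
    (hu_L2 : ∫⁻ x, ENNReal.ofReal (u x ^ 2) ∂μ < ⊤)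
    (c' : ℝ) (hc' : 0 < c')
    (h : ∀ φ : EuclideanSpace ℝ (Fin n) → ℝ, ContDiff ℝ (⊤ : ℕ∞) φ → HasCompactSupport φ →
      (∀ x, 0 ≤ φ x ∧ φ x ≤ 1) →
      ENNReal.ofReal c' * (∫⁻ x, ENNReal.ofReal (φ x ^ 4 * u x ^ 4) ∂μ) ^ ((1 : ℝ) / 2) ≤
        ∫⁻ x, ENNReal.ofReal (‖fderiv ℝ φ x‖ ^ 2 * u x ^ 2) ∂μ) :
    u =ᵐ[μ] 0 := by
  let f : ContDiffBump (0 : EuclideanSpace ℝ (Fin n)) := ⟨1, 2, by norm_num, by norm_num⟩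
  obtain ⟨M, hM⟩ : ∃ M, ∀ x, ‖fderiv ℝ f x‖ ≤ M := by
    have hc : Continuous (fderiv ℝ f) := (f.contDiff (n := 1)).continuous_fderiv (by norm_num)
    exact (f.hasCompactSupport.fderiv ℝ).exists_bound_of_continuous hc
  set I := ∫⁻ x, ENNReal.ofReal (u x ^ 2) ∂μ with hI
  -- estimate with the cutoff at scale `t`
  have key : ∀ R t : ℝ, 0 < t → R ≤ t →
      ENNReal.ofReal c' * (∫⁻ x in Metric.closedBall 0 R, ENNReal.ofReal (u x ^ 4) ∂μ)
        ^ ((1 : ℝ) / 2) ≤ ENNReal.ofReal ((t⁻¹ * M) ^ 2) * I := by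
    intro R t ht hRt
    have h1 := h (fun x => f (t⁻¹ • x)) (f.contDiff.comp (contDiff_const_smul t⁻¹))
      (f.hasCompactSupport.comp_smul (inv_ne_zero ht.ne')) (fun x => ⟨f.nonneg, f.le_one⟩)
    refine le_trans ?_ (h1.trans ?_)
    · gcongr ENNReal.ofReal c' * ?_ ^ ((1 : ℝ) / 2)
      refine le_trans ?_ (setLIntegral_le_lintegral (Metric.closedBall 0 R) _)
      refine setLIntegral_mono' Metric.isClosed_closedBall.measurableSet ?_
      intro x hx
      have : f (t⁻¹ • x) = 1 := by
        apply f.one_of_mem_closedBall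
        rw [mem_closedBall_zero_iff] at hx ⊢
        rw [norm_smul, norm_inv, Real.norm_of_nonneg ht.le, inv_mul_le_iff₀ ht]
        change ‖x‖ ≤ t * 1
        linarith
      simp [this]
    · rw [hI, ← lintegral_const_mul _ (by fun_prop)]
      refine lintegral_mono fun x => ?_
      rw [← ENNReal.ofReal_mul (by positivity)]
      apply ENNReal.ofReal_le_ofReal
      have : ‖fderiv ℝ (fun x => f (t⁻¹ • x)) x‖ ≤ t⁻¹ * M := by
        rw [fderiv_comp_smul, norm_smul, norm_inv, Real.norm_of_nonneg ht.le]
        gcongr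
        exact hM _
      gcongr
  have zero : ∀ R : ℝ, ∫⁻ x in Metric.closedBall 0 R, ENNReal.ofReal (u x ^ 4) ∂μ = 0 := by
    intro R
    have lim : Filter.Tendsto (fun t : ℝ => ENNReal.ofReal ((t⁻¹ * M) ^ 2) * I) Filter.atTop
        (nhds 0) := by
      have l1 : Filter.Tendsto (fun t : ℝ => (t⁻¹ * M) ^ 2) Filter.atTop (nhds 0) := by
        simpa using (tendsto_inv_atTop_zero.mul_const M).pow 2
      have l2 := ENNReal.Tendsto.mul_const (b := I) (ENNReal.tendsto_ofReal l1)
        (Or.inr hu_L2.ne)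
      simpa using l2
    have h0 := ge_of_tendsto lim (by
      filter_upwards [Filter.eventually_gt_atTop 0, Filter.eventually_ge_atTop R] with t h1 h2
      exact key R t h1 h2)
    have h2 := le_antisymm h0 (zero_le)
    rcases mul_eq_zero.1 h2 with h3 | h3
    · exact absurd (ENNReal.ofReal_eq_zero.1 h3) (not_le.2 hc')
    · exact (ENNReal.rpow_eq_zero_iff_of_pos (by norm_num)).1 h3
  have ae : ∀ k : ℕ, ∀ᵐ x ∂μ, x ∈ Metric.closedBall 0 (k : ℝ) → u x = 0 := by
    intro k
    have h1 := (lintegral_eq_zero_iff (by fun_prop)).1 (zero k)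
    have h2 := (ae_restrict_iff' Metric.isClosed_closedBall.measurableSet).1 h1
    filter_upwards [h2] with x hx hk
    have h3 : u x ^ 4 ≤ 0 := ENNReal.ofReal_eq_zero.1 (hx hk)
    exact pow_eq_zero_iff (by norm_num) |>.1 (le_antisymm h3 (by positivity))
  filter_upwards [ae_all_iff.2 ae] with x hx
  obtain ⟨k, hk⟩ := exists_nat_ge ‖x‖
  exact hx k (by simpa using hk)
end

section
/- Let n ≥ 1, let μ be a measure on Euclidean space ℝⁿ, and let u : ℝⁿ → ℝ be a nonnegative measurable function such that ∫ u² dμ < ∞ and u⁴ is integrable on every compact set. Let Λ₀ > 0 and c ≥ 0 be constants with c·(∫ u² dμ)^{1/2} < Λ₀. Suppose that for every smooth compactly supported function φ : ℝⁿ → ℝ with 0 ≤ φ ≤ 1 one has Λ₀·(∫ φ⁴ u⁴ dμ)^{1/2} ≤ ∫ ‖Dφ‖² u² dμ + c·∫ φ² u³ dμ. Then u = 0 μ-almost everywhere. -/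
open MeasureTheory in
/-- Analytic core of the rigidity theorems: if a nonnegative measurable `u` with `∫ u² dμ < ∞`
and `u⁴` locally integrable on compact sets satisfies
`Λ₀ * (∫ φ⁴ u⁴ dμ)^{1/2} ≤ ∫ ‖Dφ‖² u² dμ + c * ∫ φ² u³ dμ` for all smooth compactly supported
cutoffs `0 ≤ φ ≤ 1`, where `c * (∫ u² dμ)^{1/2} < Λ₀`, then `u = 0` μ-a.e. -/
theorem vanishing_from_cutoff_estimate_with_cubic_term (n : ℕ) (hn : 1 ≤ n)
    (μ : Measure (EuclideanSpace ℝ (Fin n)))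
    (u : EuclideanSpace ℝ (Fin n) → ℝ) (hu_meas : Measurable u) (hu_nonneg : ∀ x, 0 ≤ u x)
    (hu_L2 : ∫⁻ x, ENNReal.ofReal (u x ^ 2) ∂μ < ⊤)
    (hu_L4loc : ∀ K : Set (EuclideanSpace ℝ (Fin n)), IsCompact K →
      ∫⁻ x in K, ENNReal.ofReal (u x ^ 4) ∂μ < ⊤)
    (Λ₀ c : ℝ) (hΛ₀ : 0 < Λ₀) (hc : 0 ≤ c)
    (hsmall : ENNReal.ofReal c * (∫⁻ x, ENNReal.ofReal (u x ^ 2) ∂μ) ^ ((1 : ℝ) / 2) <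
      ENNReal.ofReal Λ₀)
    (h : ∀ φ : EuclideanSpace ℝ (Fin n) → ℝ, ContDiff ℝ (⊤ : ℕ∞) φ → HasCompactSupport φ →
      (∀ x, 0 ≤ φ x ∧ φ x ≤ 1) →
      ENNReal.ofReal Λ₀ * (∫⁻ x, ENNReal.ofReal (φ x ^ 4 * u x ^ 4) ∂μ) ^ ((1 : ℝ) / 2) ≤
        ∫⁻ x, ENNReal.ofReal (‖fderiv ℝ φ x‖ ^ 2 * u x ^ 2) ∂μ +
          ENNReal.ofReal c * ∫⁻ x, ENNReal.ofReal (φ x ^ 2 * u x ^ 3) ∂μ) :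
    u =ᵐ[μ] 0 := by
  -- a fixed cutoff
  let ψ : ContDiffBump (0 : EuclideanSpace ℝ (Fin n)) := ⟨1, 2, one_pos, one_lt_two⟩
  have hψs : ContDiff ℝ (⊤ : ℕ∞) (ψ : EuclideanSpace ℝ (Fin n) → ℝ) := ψ.contDiff
  have hψc : HasCompactSupport (ψ : EuclideanSpace ℝ (Fin n) → ℝ) := ψ.hasCompactSupport
  obtain ⟨C, hC⟩ := (hψs.continuous_fderiv (by simp)).bounded_above_of_compact_support
    (hψc.fderiv ℝ)
  set I := ∫⁻ x, ENNReal.ofReal (u x ^ 2) ∂μ with hI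
  set cN := ENNReal.ofReal c * I ^ ((1 : ℝ) / 2) with hcN
  have key : ∀ t : ℝ, 0 < t →
      (ENNReal.ofReal Λ₀ - cN) *
        (∫⁻ x in Metric.closedBall 0 t, ENNReal.ofReal (u x ^ 4) ∂μ) ^ ((1 : ℝ) / 2) ≤
        ENNReal.ofReal ((C * t⁻¹) ^ 2) * I := by
    intro t ht
    set φ : EuclideanSpace ℝ (Fin n) → ℝ := fun x => ψ (t⁻¹ • x) with hφ
    have hφs : ContDiff ℝ (⊤ : ℕ∞) φ := hψs.comp (contDiff_const_smul _)
    have hφc : HasCompactSupport φ := hψc.comp_smul (inv_ne_zero ht.ne')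
    have hφ01 : ∀ x, 0 ≤ φ x ∧ φ x ≤ 1 := fun x => ⟨ψ.nonneg, ψ.le_one⟩
    have hφm : Measurable φ := hφs.continuous.measurable
    have hd : ∀ x, ‖fderiv ℝ φ x‖ ≤ C * t⁻¹ := by
      intro x
      have h1 : fderiv ℝ φ x = t⁻¹ • fderiv ℝ ψ (t⁻¹ • x) := by
        exact fderiv_comp_smul _
      rw [h1, norm_smul, Real.norm_of_nonneg (inv_nonneg.2 ht.le), mul_comm]
      exact mul_le_mul_of_nonneg_right (hC _) (inv_nonneg.2 ht.le)
    have hmain := h φ hφs hφc hφ01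
    set J := ∫⁻ x, ENNReal.ofReal (φ x ^ 4 * u x ^ 4) ∂μ with hJ
    have hJfin : J < ⊤ := by
      refine lt_of_le_of_lt ?_ (hu_L4loc (tsupport φ) hφc)
      rw [← lintegral_indicator (isClosed_tsupport φ).measurableSet]
      refine lintegral_mono fun x => ?_
      by_cases hx : x ∈ tsupport φ
      · rw [Set.indicator_of_mem hx]
        refine ENNReal.ofReal_le_ofReal ?_
        exact mul_le_of_le_one_left (by positivity) (pow_le_one₀ (hφ01 x).1 (hφ01 x).2)
      · simp [image_eq_zero_of_notMem_tsupport hx]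
    have hgrad : ∫⁻ x, ENNReal.ofReal (‖fderiv ℝ φ x‖ ^ 2 * u x ^ 2) ∂μ ≤
        ENNReal.ofReal ((C * t⁻¹) ^ 2) * I := by
      rw [hI, ← lintegral_const_mul _ (by fun_prop)]
      refine lintegral_mono fun x => ?_
      rw [← ENNReal.ofReal_mul (by positivity)]
      refine ENNReal.ofReal_le_ofReal ?_
      have := hd x
      gcongr
    have hcub : ∫⁻ x, ENNReal.ofReal (φ x ^ 2 * u x ^ 3) ∂μ ≤
        J ^ ((1 : ℝ) / 2) * I ^ ((1 : ℝ) / 2) := by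
      have h2 := ENNReal.lintegral_mul_le_Lp_mul_Lq μ Real.HolderConjugate.two_two
        (f := fun x => ENNReal.ofReal (φ x ^ 2 * u x ^ 2)) (g := fun x => ENNReal.ofReal (u x))
        (by fun_prop) (by fun_prop)
      have e1 : ∀ x, ENNReal.ofReal (φ x ^ 2 * u x ^ 2) ^ (2 : ℝ) =
          ENNReal.ofReal (φ x ^ 4 * u x ^ 4) := by
        intro x
        rw [ENNReal.rpow_ofNat, ← ENNReal.ofReal_pow (by positivity)]
        congr 1; ring
      have e2 : ∀ x, ENNReal.ofReal (u x) ^ (2 : ℝ) = ENNReal.ofReal (u x ^ 2) := by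
        intro x
        rw [ENNReal.rpow_ofNat, ← ENNReal.ofReal_pow (hu_nonneg x)]
      have e3 : ∀ x, ENNReal.ofReal (φ x ^ 2 * u x ^ 2) * ENNReal.ofReal (u x) =
          ENNReal.ofReal (φ x ^ 2 * u x ^ 3) := by
        intro x
        rw [← ENNReal.ofReal_mul (by positivity)]
        congr 1; ring
      simpa only [Pi.mul_apply, e1, e2, e3] using h2
    have hA : J ^ ((1 : ℝ) / 2) ≠ ⊤ := ENNReal.rpow_ne_top_of_nonneg (by norm_num) hJfin.ne
    have hBJ : ∫⁻ x in Metric.closedBall 0 t, ENNReal.ofReal (u x ^ 4) ∂μ ≤ J := by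
      rw [← lintegral_indicator Metric.isClosed_closedBall.measurableSet]
      refine lintegral_mono fun x => ?_
      by_cases hx : x ∈ Metric.closedBall (0 : EuclideanSpace ℝ (Fin n)) t
      · rw [Set.indicator_of_mem hx]
        have : φ x = 1 := by
          refine ψ.one_of_mem_closedBall ?_
          rw [mem_closedBall_zero_iff] at hx ⊢
          change ‖t⁻¹ • x‖ ≤ 1
          rw [norm_smul, Real.norm_of_nonneg (inv_nonneg.2 ht.le), inv_mul_le_iff₀ ht]
          simpa using hx
        simp [this]
      · simp [Set.indicator_of_notMem hx]
    calc _ ≤ (ENNReal.ofReal Λ₀ - cN) * J ^ ((1 : ℝ) / 2) := by gcongr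
      _ = ENNReal.ofReal Λ₀ * J ^ ((1 : ℝ) / 2) - cN * J ^ ((1 : ℝ) / 2) :=
        ENNReal.sub_mul fun _ _ => hA
      _ ≤ ENNReal.ofReal ((C * t⁻¹) ^ 2) * I := by
        rw [tsub_le_iff_right]
        refine hmain.trans (add_le_add hgrad ?_)
        calc _ ≤ ENNReal.ofReal c * (J ^ ((1 : ℝ) / 2) * I ^ ((1 : ℝ) / 2)) := by gcongr
          _ = _ := by rw [hcN]; ring
  -- let the radius tend to infinity
  have hlim : Filter.Tendsto (fun t : ℝ => ENNReal.ofReal ((C * t⁻¹) ^ 2) * I) Filter.atTop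
      (nhds 0) := by
    have h1 : Filter.Tendsto (fun t : ℝ => (C * t⁻¹) ^ 2) Filter.atTop (nhds 0) := by
      simpa using (tendsto_inv_atTop_zero.const_mul C).pow 2
    have h2 := ENNReal.Tendsto.mul_const (ENNReal.tendsto_ofReal h1) (Or.inr hu_L2.ne)
    simpa using h2
  have hzero : ∀ m : ℕ,
      ∫⁻ x in Metric.closedBall 0 (m : ℝ), ENNReal.ofReal (u x ^ 4) ∂μ = 0 := by
    intro m
    have h1 : (ENNReal.ofReal Λ₀ - cN) *
        (∫⁻ x in Metric.closedBall 0 (m : ℝ), ENNReal.ofReal (u x ^ 4) ∂μ) ^ ((1 : ℝ) / 2) ≤ 0 := by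
      refine ge_of_tendsto hlim ?_
      filter_upwards [Filter.eventually_ge_atTop (m : ℝ), Filter.eventually_gt_atTop (0 : ℝ)]
        with t hmt ht
      refine le_trans ?_ (key t ht)
      gcongr
    have h2 := (mul_eq_zero.1 (le_zero_iff.1 h1)).resolve_left (tsub_pos_of_lt hsmall).ne'
    rw [ENNReal.rpow_eq_zero_iff] at h2
    rcases h2 with h2 | h2
    · exact h2.1
    · norm_num at h2
  have hae : ∀ m : ℕ, ∀ᵐ x ∂μ, x ∈ Metric.closedBall 0 (m : ℝ) → u x = 0 := by
    intro m
    have h1 := hzero m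
    rw [lintegral_eq_zero_iff (by fun_prop), Filter.EventuallyEq,
      ae_restrict_iff' Metric.isClosed_closedBall.measurableSet] at h1
    filter_upwards [h1] with x hx hxm
    have h3 := hx hxm
    simp only [Pi.zero_apply, ENNReal.ofReal_eq_zero] at h3
    exact pow_eq_zero_iff (n := 4) (by norm_num) |>.1 (le_antisymm h3 (by positivity))
  filter_upwards [ae_all_iff.2 hae] with x hx
  obtain ⟨m, hm⟩ := exists_nat_ge ‖x‖
  exact hx m (by simpa using hm)
end
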